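/- Let e = {i,j} be an edge of a finite simple graph G with CS(i,G) ≥ 2 and CS(j,G) ≥ 2. Then removing e changes no core value: C(u, G−e) = C(u,G) for every vertex u. -/

import Mathlib

/-- A set `S` of vertices is `k`-supported in `G` if every vertex of `S`
has at least `k` neighbors inside `S`. -/
def kSupported {V : Type*} (G : SimpleGraph V) (k : ℕ) (S : Set V) : Prop :=
  ∀ i ∈ S, k ≤ {j | j ∈ S ∧ G.Adj i j}.ncard

/-- The `k`-core of `G`: the union of all `k`-supported sets. -/
def kCore {V : Type*} (G : SimpleGraph V) (k : ℕ) : Set V :=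
  ⋃₀ {S | kSupported G k S}

/-- The core value `C(i,G)` of a vertex `i`: the largest `k` with `i ∈ V_k(G)`. -/
noncomputable def coreValue {V : Type*} (G : SimpleGraph V) (i : V) : ℕ :=
  sSup {k | i ∈ kCore G k}

/-- The supportive neighbors of `i` at level `k`:
neighbors `j` of `i` with core value at least `k`. -/
def SN {V : Type*} (G : SimpleGraph V) (i : V) (k : ℕ) : Set V :=
  {j | G.Adj i j ∧ k ≤ coreValue G j}

/-- `SN(i,G)`: abbreviation for `SN(i, C(i,G), G)`. -/
noncomputable def SNc {V : Type*} (G : SimpleGraph V) (i : V) : Set V :=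
  SN G i (coreValue G i)

/-- The core strength `CS(i,G) = |SN(i,G)| - C(i,G) + 1`. -/
noncomputable def CS {V : Type*} (G : SimpleGraph V) (i : V) : ℕ :=
  (SNc G i).ncard - coreValue G i + 1

theorem kSupported.mono {V : Type*} [Finite V] {G H : SimpleGraph V} (h : G ≤ H) {k l : ℕ}
    (hlk : l ≤ k) {S : Set V} (hS : kSupported G k S) : kSupported H l S := fun v hv =>
  hlk.trans <| (hS v hv).trans <|
    Set.ncard_le_ncard (fun _ hw => ⟨hw.1, h hw.2⟩) (Set.toFinite _)

theorem kCore_mono {V : Type*} [Finite V] {G H : SimpleGraph V} (h : G ≤ H) {k l : ℕ}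
    (hlk : l ≤ k) : kCore G k ⊆ kCore H l := by
  rintro v ⟨S, hS, hv⟩
  exact ⟨S, kSupported.mono h hlk hS, hv⟩

theorem bddAbove_mem_kCore {V : Type*} [Finite V] (G : SimpleGraph V) (v : V) :
    BddAbove {k | v ∈ kCore G k} := by
  refine ⟨Nat.card V, ?_⟩
  rintro k ⟨S, hS, hv⟩
  exact (hS v hv).trans (Set.ncard_le_card _)

theorem mem_kCore_zero {V : Type*} (G : SimpleGraph V) (v : V) : v ∈ kCore G 0 :=
  ⟨Set.univ, fun _ _ => Nat.zero_le _, Set.mem_univ v⟩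

theorem le_coreValue_iff {V : Type*} [Finite V] {G : SimpleGraph V} {v : V} {k : ℕ} :
    k ≤ coreValue G v ↔ v ∈ kCore G k := by
  refine ⟨fun h => ?_, fun h => le_csSup (bddAbove_mem_kCore G v) h⟩
  exact kCore_mono le_rfl h (Nat.sSup_mem ⟨0, mem_kCore_zero G v⟩ (bddAbove_mem_kCore G v))

theorem kSupported_kCore {V : Type*} [Finite V] (G : SimpleGraph V) (k : ℕ) :
    kSupported G k (kCore G k) := by
  rintro v ⟨S, hS, hv⟩
  exact (hS v hv).trans <|
    Set.ncard_le_ncard (fun w hw => ⟨⟨S, hS, hw.1⟩, hw.2⟩) (Set.toFinite _)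

/-- A vertex of core strength at least two keeps `k` neighbors in the `k`-core
after losing any one neighbor. -/
theorem le_ncard_neighbors_kCore_diff_singleton {V : Type*} [Finite V] {G : SimpleGraph V}
    {v : V} {k : ℕ} (hv : v ∈ kCore G k) (hs : 2 ≤ CS G v) (w : V) :
    k ≤ ({x | x ∈ kCore G k ∧ G.Adj v x} \ {w}).ncard := by
  have hk := le_coreValue_iff.2 hv
  have hsub : (SNc G v).ncard ≤ {x | x ∈ kCore G k ∧ G.Adj v x}.ncard :=
    Set.ncard_le_ncard (fun x hx => ⟨le_coreValue_iff.1 (hk.trans hx.2), hx.1⟩) (Set.toFinite _)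
  have hdiff := Set.pred_ncard_le_ncard_sdiff_singleton {x | x ∈ kCore G k ∧ G.Adj v x} w
  unfold CS at hs
  omega

theorem kSupported_deleteEdges_kCore {V : Type*} [Finite V] {G : SimpleGraph V} {i j : V}
    (hi : 2 ≤ CS G i) (hj : 2 ≤ CS G j) (k : ℕ) :
    kSupported (G.deleteEdges {s(i, j)}) k (kCore G k) := by
  intro v hv
  by_cases hvi : v = i
  · subst hvi
    refine (le_ncard_neighbors_kCore_diff_singleton hv hi j).trans
      (Set.ncard_le_ncard ?_ (Set.toFinite _))
    rintro x ⟨⟨hx, hadj⟩, hne⟩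
    refine ⟨hx, ?_⟩
    simp_all [SimpleGraph.deleteEdges_adj]
  by_cases hvj : v = j
  · subst hvj
    refine (le_ncard_neighbors_kCore_diff_singleton hv hj i).trans
      (Set.ncard_le_ncard ?_ (Set.toFinite _))
    rintro x ⟨⟨hx, hadj⟩, hne⟩
    refine ⟨hx, ?_⟩
    simp_all [SimpleGraph.deleteEdges_adj]
  · refine (kSupported_kCore G k v hv).trans (Set.ncard_le_ncard ?_ (Set.toFinite _))
    rintro x ⟨hx, hadj⟩
    refine ⟨hx, ?_⟩
    simp_all [SimpleGraph.deleteEdges_adj]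

theorem stmt_10 {V : Type*} [Fintype V] (G : SimpleGraph V) (i j : V)
    (hij : G.Adj i j) (hi : 2 ≤ CS G i) (hj : 2 ≤ CS G j) (u : V) :
    coreValue (G.deleteEdges {s(i, j)}) u = coreValue G u := by
  apply le_antisymm
  · exact le_coreValue_iff.2
      (kCore_mono (SimpleGraph.deleteEdges_le _) le_rfl (le_coreValue_iff.1 le_rfl))
  · exact le_coreValue_iff.2
      ⟨_, kSupported_deleteEdges_kCore hi hj _, le_coreValue_iff.1 le_rfl⟩
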